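/- Let f : ℝ^p × ℝ^q → ℝ be continuously differentiable, α-marginally strongly convex and β-marginally strongly smooth in both its variables, and satisfy C-robust bistability. Let (x*, y*) be a global minimizer of f with ∇f(x*, y*) = 0. Then for every (x, y) ∈ ℝ^p × ℝ^q, every ỹ ∈ mOPT_f(x), and every x̃ ∈ mOPT_f(y): ‖x − x*‖₂² + ‖y − y*‖₂² ≤ (Cβ/α)·(‖x − x̃‖₂² + ‖y − ỹ‖₂²). -/

import Mathlib

open scoped RealInnerProductSpace

theorem HasGradientAt.eq_zero_of_forall_le {E : Type*} [NormedAddCommGroup E]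
    [InnerProductSpace ℝ E] [CompleteSpace E] {φ : E → ℝ} {g a : E}
    (h : HasGradientAt φ g a) (hmin : ∀ x, φ a ≤ φ x) : g = 0 := by
  have hz := IsLocalMin.hasFDerivAt_eq_zero (Filter.Eventually.of_forall hmin) h.hasFDerivAt
  simpa using hz

/-- For a continuously differentiable function that is `α`-MSC and `β`-MSS in both of its
variables and satisfies `C`-robust bistability, with a global minimizer `(x*, y*)` having
vanishing gradient, every point `(x, y)` with marginally optimal coordinates `x̃, ỹ`
satisfies `‖x - x*‖² + ‖y - y*‖² ≤ (Cβ/α)(‖x - x̃‖² + ‖y - ỹ‖²)`. -/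
theorem gam_local_to_global
    {p q : ℕ}
    (f : EuclideanSpace ℝ (Fin p) → EuclideanSpace ℝ (Fin q) → ℝ)
    (gx : EuclideanSpace ℝ (Fin p) → EuclideanSpace ℝ (Fin q) → EuclideanSpace ℝ (Fin p))
    (gy : EuclideanSpace ℝ (Fin p) → EuclideanSpace ℝ (Fin q) → EuclideanSpace ℝ (Fin q))
    (hgx : ∀ x y, HasGradientAt (fun x' => f x' y) (gx x y) x)
    (hgy : ∀ x y, HasGradientAt (fun y' => f x y') (gy x y) y)
    (α β C : ℝ) (hα : 0 < α) (hβ : 0 < β) (hC : 0 < C)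
    (hmscx : ∀ y x1 x2,
      (α/2) * ‖x2 - x1‖^2 ≤ f x2 y - f x1 y - ⟪gx x1 y, x2 - x1⟫ ∧
      f x2 y - f x1 y - ⟪gx x1 y, x2 - x1⟫ ≤ (β/2) * ‖x2 - x1‖^2)
    (hmscy : ∀ x y1 y2,
      (α/2) * ‖y2 - y1‖^2 ≤ f x y2 - f x y1 - ⟪gy x y1, y2 - y1⟫ ∧
      f x y2 - f x y1 - ⟪gy x y1, y2 - y1⟫ ≤ (β/2) * ‖y2 - y1‖^2)
    (xs : EuclideanSpace ℝ (Fin p)) (ys : EuclideanSpace ℝ (Fin q))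
    (hmin : ∀ x y, f xs ys ≤ f x y)
    (hgxs : gx xs ys = 0) (hgys : gy xs ys = 0)
    (hrb : ∀ x y xtil ytil,
      (∀ y', f x ytil ≤ f x y') → (∀ x', f xtil y ≤ f x' y) →
      f x ys + f xs y - 2 * f xs ys ≤ C * (2 * f x y - f x ytil - f xtil y)) :
    ∀ x y xtil ytil,
      (∀ y', f x ytil ≤ f x y') → (∀ x', f xtil y ≤ f x' y) →
      ‖x - xs‖^2 + ‖y - ys‖^2 ≤ (C * β / α) * (‖x - xtil‖^2 + ‖y - ytil‖^2) := by
  intro x y xtil ytil hytil hxtil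
  have hgx0 : gx xtil y = 0 := (hgx xtil y).eq_zero_of_forall_le hxtil
  have hgy0 : gy x ytil = 0 := (hgy x ytil).eq_zero_of_forall_le hytil
  have lower_x := (hmscx ys xs x).1
  have lower_y := (hmscy xs ys y).1
  have upper_x := (hmscx y xtil x).2
  have upper_y := (hmscy x ytil y).2
  simp only [hgxs, hgys, hgx0, hgy0, inner_zero_left, sub_zero] at lower_x lower_y upper_x upper_y
  have bistable := hrb x y xtil ytil hytil hxtil
  have gap : C * (2 * f x y - f x ytil - f xtil y) ≤
      C * (β / 2 * (‖x - xtil‖ ^ 2 + ‖y - ytil‖ ^ 2)) :=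
    mul_le_mul_of_nonneg_left (by linarith) hC.le
  rw [div_mul_eq_mul_div, le_div_iff₀ hα]
  linarith
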